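/- The measure μ_p is doubling on [0,1] if and only if there exists a constant C₁′ > 0 such that for every n ≥ 2 and every j with 0 ≤ j ≤ #X_n − 3, one has (C₁′)^{−1} ≤ μ_p([a_{n,j}, a_{n,j+1}]) / μ_p([a_{n,j+1}, a_{n,j+2}]) ≤ C₁′. -/

import Mathlib

open MeasureTheory

noncomputable section

/-- The contraction maps: `Smap β 0 = S₁ : x ↦ x/β` and `Smap β 1 = S₂ : x ↦ x/β + (1 - 1/β)`. -/
def Smap (β : ℝ) (i : Fin 2) (x : ℝ) : ℝ :=
  if i = 0 then x / β else x / β + (1 - 1 / β)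

/-- `Sapply β I = S_I = S_{i₁} ∘ ⋯ ∘ S_{i_n}` for a word `I = i₁…i_n ∈ {1,2}^n`. -/
def Sapply (β : ℝ) : {n : ℕ} → (Fin n → Fin 2) → ℝ → ℝ
  | 0, _, x => x
  | _+1, I, x => Smap β (I 0) (Sapply β (fun k => I k.succ) x)

/-- `Xn β n = {S_I(0) : I ∈ {1,2}^n} ∪ {1}`. -/
def Xn (β : ℝ) (n : ℕ) : Finset ℝ :=
  (Finset.univ.image fun I : Fin n → Fin 2 => Sapply β I 0) ∪ {1}

/-- `pt β n j = a_{n,j}`, the `j`-th element of `Xn β n` in increasing order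
(junk value `0` if `j` is out of range). -/
def pt (β : ℝ) (n j : ℕ) : ℝ := ((Xn β n).sort (· ≤ ·)).getD j 0

/-- The sequence `d₀ = 1`, `d₁ = β - 1`, `d_{j+1} = β·d_j - d₁`. -/
def dd (β : ℝ) : ℕ → ℝ
  | 0 => 1
  | 1 => β - 1
  | j+2 => β * dd β (j+1) - (β - 1)

/-- The weight of a letter: `pw p₁ p₂ i = p_{i+1}`. -/
def pw (p1 p2 : ℝ) (i : Fin 2) : ℝ := if i = 0 then p1 else p2

/-- `Wn β p₁ p₂ n x = W_n(x) = ∑_{S_I(0)=x, |I|=n} p_I`. -/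
def Wn (β p1 p2 : ℝ) (n : ℕ) (x : ℝ) : ℝ :=
  ∑ I : Fin n → Fin 2, if Sapply β I 0 = x then ∏ k, pw p1 p2 (I k) else 0

/-- A measure with support `[0,1]` is doubling if
`sup { μ(B(x,2r))/μ(B(x,r)) : x ∈ supp μ = [0,1], r > 0 } < ∞`. -/
def IsDoubling (μ : Measure ℝ) : Prop :=
  (⨆ (x : ℝ) (_ : x ∈ Set.Icc (0:ℝ) 1) (r : ℝ) (_ : 0 < r),
    μ (Metric.closedBall x (2 * r)) / μ (Metric.closedBall x r)) < ⊤


/-- Left endpoints of level `n`. -/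
def YY (β : ℝ) (n : ℕ) : Set ℝ := Set.range (fun I : Fin n → Fin 2 => Sapply β I 0)

lemma mem_YY_zero (β y : ℝ) : y ∈ YY β 0 ↔ y = 0 := by
  constructor
  · rintro ⟨I, rfl⟩; rfl
  · rintro rfl; exact ⟨Fin.elim0, rfl⟩

lemma mem_YY_front (β : ℝ) (n : ℕ) (y : ℝ) :
    y ∈ YY β (n+1) ↔ ∃ x ∈ YY β n, y = x / β ∨ y = x / β + (1 - 1 / β) := by
  constructor
  · rintro ⟨I, rfl⟩
    refine ⟨_, ⟨fun k => I k.succ, rfl⟩, ?_⟩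
    by_cases h : I 0 = 0
    · left; simp [Sapply, Smap, h]
    · right; simp [Sapply, Smap, h]
  · rintro ⟨x, ⟨I, rfl⟩, h | h⟩
    · refine ⟨Fin.cons 0 I, ?_⟩
      simp [Sapply, Smap, h]
    · refine ⟨Fin.cons 1 I, ?_⟩
      simp [Sapply, Smap, h]

lemma mem_YY_back (β : ℝ) (hβ : 1 < β) (n : ℕ) : ∀ y : ℝ,
    y ∈ YY β (n+1) ↔ ∃ x ∈ YY β n, y = x ∨ y = x + (β - 1) / β ^ (n+1) := by
  have hb : β ≠ 0 := by linarith
  induction n with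
  | zero =>
    intro y
    rw [mem_YY_front]
    simp only [mem_YY_zero, exists_eq_left, zero_add, zero_div, pow_one]
    rw [show 1 - 1 / β = (β - 1) / β by field_simp]
  | succ n ih =>
    intro y
    rw [mem_YY_front]
    constructor
    · rintro ⟨x, hx, h⟩
      obtain ⟨w, hw, hxw⟩ := (ih x).1 hx
      rcases hxw with rfl | rfl
      · exact ⟨y, (mem_YY_front _ _ _).2 ⟨x, hw, h⟩, Or.inl rfl⟩
      · rcases h with h | h
        · refine ⟨w / β, (mem_YY_front _ _ _).2 ⟨w, hw, Or.inl rfl⟩, Or.inr ?_⟩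
          rw [h]; field_simp; ring
        · refine ⟨w / β + (1 - 1 / β), (mem_YY_front _ _ _).2 ⟨w, hw, Or.inr rfl⟩, Or.inr ?_⟩
          rw [h]; field_simp; ring
    · rintro ⟨x, hx, h⟩
      obtain ⟨w, hw, hxw⟩ := (mem_YY_front _ _ _).1 hx
      rcases h with rfl | rfl
      · exact ⟨w, (ih w).2 ⟨w, hw, Or.inl rfl⟩, hxw⟩
      · refine ⟨w + (β - 1) / β ^ (n+1), (ih _).2 ⟨w, hw, Or.inr rfl⟩, ?_⟩
        rcases hxw with h | h
        · left; rw [h]; field_simp; ring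
        · right; rw [h]; field_simp; ring

lemma YY_bounds (β : ℝ) (hβ : 1 < β) (n : ℕ) : ∀ y ∈ YY β n, 0 ≤ y ∧ y < 1 := by
  have hb : 0 < β := by linarith
  induction n with
  | zero => intro y hy; rw [mem_YY_zero] at hy; subst hy; norm_num
  | succ n ih =>
    intro y hy
    obtain ⟨x, hx, h⟩ := (mem_YY_front _ _ _).1 hy
    obtain ⟨h0, h1⟩ := ih x hx
    have e1 : x / β < 1 / β := by gcongr
    have e2 : 0 ≤ x / β := by positivity
    have e3 : 1 / β < 1 := by rw [div_lt_one hb]; exact hβ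
    rcases h with rfl | rfl <;> constructor <;> linarith

lemma zero_mem_YY (β : ℝ) (hβ : 1 < β) (n : ℕ) : (0:ℝ) ∈ YY β n := by
  induction n with
  | zero => rw [mem_YY_zero]
  | succ n ih => exact (mem_YY_back β hβ n 0).2 ⟨0, ih, Or.inl rfl⟩

/-- The set of normalised gap lengths. -/
def DD (m : ℕ) (β : ℝ) : Set ℝ := {d | d = 1 ∨ ∃ i < m, d = 1 - β ^ i * (2 - β)}

lemma key_eq (m : ℕ) (β : ℝ) (hβ : β ^ m = ∑ j ∈ Finset.range m, β ^ j) :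
    β ^ m * (2 - β) = 1 := by
  have := mul_geom_sum β m
  rw [← hβ] at this
  linarith

lemma DD_bounds (m : ℕ) (β : ℝ) (hβ1 : 1 < β) (hβ2 : β < 2)
    (hk : β ^ m * (2 - β) = 1) (d : ℝ) (hd : d ∈ DD m β) : 1 - 1 / β ≤ d ∧ d ≤ 1 := by
  have hb : 0 < β := by linarith
  rcases hd with rfl | ⟨i, hi, rfl⟩
  · have : 0 < 1 / β := by positivity
    constructor <;> linarith
  · have h1 : 0 < β ^ i * (2 - β) := mul_pos (by positivity) (by linarith)
    have h2 : β ^ i * (2 - β) ≤ 1 / β := by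
      rw [le_div_iff₀ hb]
      have : β ^ (i+1) ≤ β ^ m := pow_le_pow_right₀ hβ1.le hi
      have h3 : β ^ (i+1) * (2 - β) ≤ β ^ m * (2 - β) :=
        mul_le_mul_of_nonneg_right this (by linarith)
      calc _ = β ^ (i+1) * (2 - β) := by ring
        _ ≤ _ := by rw [← hk]; exact h3
    constructor <;> linarith

lemma DD_step (m : ℕ) (β : ℝ) (hk : β ^ m * (2 - β) = 1) (d : ℝ) (hd : d ∈ DD m β) :
    β * d - (β - 1) = 0 ∨ β * d - (β - 1) ∈ DD m β := by
  rcases hd with rfl | ⟨i, hi, rfl⟩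
  · right; left; ring
  · have e : β * (1 - β ^ i * (2 - β)) - (β - 1) = 1 - β ^ (i+1) * (2 - β) := by ring
    rw [e]
    rcases Nat.lt_or_ge (i+1) m with h | h
    · right; right; exact ⟨i+1, h, rfl⟩
    · left
      have : i + 1 = m := by omega
      rw [this, hk]; ring

lemma gap (m : ℕ) (hm : 2 ≤ m) (β : ℝ) (hβ1 : 1 < β) (hβ2 : β < 2)
    (hk : β ^ m * (2 - β) = 1) (n : ℕ) : ∀ a ∈ YY β n, ∃ d ∈ DD m β,
      (a + d / β ^ n ∈ YY β n ∨ a + d / β ^ n = 1) ∧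
      ∀ y, (y ∈ YY β n ∨ y = 1) → y ≤ a ∨ a + d / β ^ n ≤ y := by
  have hb : 0 < β := by linarith
  induction n with
  | zero =>
    intro a ha
    rw [mem_YY_zero] at ha
    subst ha
    refine ⟨1, Or.inl rfl, Or.inr (by simp), ?_⟩
    rintro y (hy | rfl)
    · rw [mem_YY_zero] at hy; left; linarith
    · right; simp
  | succ n ih =>
    have hP : 0 < β ^ (n+1) := by positivity
    set δ := (β - 1) / β ^ (n+1) with hδ
    have hδ0 : 0 < δ := div_pos (by linarith) hP
    have hrel : ∀ d : ℝ, d / β ^ n = δ + (β * d - (β - 1)) / β ^ (n+1) := by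
      intro d; rw [hδ]; field_simp; ring
    have hnn : ∀ d ∈ DD m β, δ ≤ d / β ^ n := by
      intro d hd
      rw [hrel d]
      have : 0 ≤ β * d - (β - 1) := by
        rcases DD_step m β hk d hd with h | h
        · exact h.ge
        · have := (DD_bounds m β hβ1 hβ2 hk _ h).1
          have : 1 / β < 1 := by rw [div_lt_one hb]; exact hβ1
          linarith
      have := div_nonneg this hP.le
      linarith
    -- points of level n keep their place
    have case1 : ∀ x ∈ YY β n, ∃ d ∈ DD m β,
      (x + d / β ^ (n+1) ∈ YY β (n+1) ∨ x + d / β ^ (n+1) = 1) ∧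
      ∀ y, (y ∈ YY β (n+1) ∨ y = 1) → y ≤ x ∨ x + d / β ^ (n+1) ≤ y := by
      intro x hx
      obtain ⟨d, hd, h1, h2⟩ := ih x hx
      refine ⟨β - 1, Or.inr ⟨0, by omega, by ring⟩,
        Or.inl ((mem_YY_back β hβ1 n _).2 ⟨x, hx, Or.inr rfl⟩), ?_⟩
      rw [← hδ]
      have hdd := hnn d hd
      have aux : ∀ y, (y ∈ YY β n ∨ y = 1) → y ≤ x ∨ x + δ ≤ y := by
        intro y hy
        rcases h2 y hy with h | h
        · exact Or.inl h
        · right; linarith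
      rintro w (hw | hw)
      · obtain ⟨y, hy, h | h⟩ := (mem_YY_back β hβ1 n _).1 hw
        · subst h; exact aux _ (Or.inl hy)
        · rw [← hδ] at h
          rcases le_or_gt x y with hxy | hxy
          · right; linarith
          · left
            obtain ⟨d', hd', -, h2'⟩ := ih y hy
            have := hnn d' hd'
            rcases h2' x (Or.inl hx) with h3 | h3 <;> linarith
      · exact aux _ (Or.inr hw)
    intro a ha
    obtain ⟨x, hx, h | h⟩ := (mem_YY_back β hβ1 n _).1 ha
    · subst h; exact case1 _ hx
    · rw [← hδ] at h
      obtain ⟨d, hd, h1, h2⟩ := ih x hx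
      rcases DD_step m β hk d hd with h0 | h0
      · have e : x + d / β ^ n = a := by rw [hrel, h0, h]; simp
        rw [e] at h1
        rcases h1 with h1 | h1
        · exact case1 _ h1
        · have := (YY_bounds β hβ1 _ a ha).2
          linarith
      · have e : a + (β * d - (β - 1)) / β ^ (n+1) = x + d / β ^ n := by
          rw [hrel d, h]; ring
        refine ⟨_, h0, ?_, ?_⟩
        · rw [e]
          rcases h1 with h1 | h1
          · left; exact (mem_YY_back β hβ1 n _).2 ⟨_, h1, Or.inl rfl⟩
          · right; exact h1
        · rw [e]
          have aux : ∀ y, (y ∈ YY β n ∨ y = 1) → y ≤ a ∨ x + d / β ^ n ≤ y := by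
            intro y hy
            rcases h2 y hy with h | h
            · left; linarith
            · exact Or.inr h
          rintro w (hw | hw)
          · obtain ⟨y, hy, h' | h'⟩ := (mem_YY_back β hβ1 n _).1 hw
            · subst h'; exact aux _ (Or.inl hy)
            · rw [← hδ] at h'
              rcases h2 y (Or.inl hy) with h3 | h3
              · left; linarith
              · right; linarith
          · exact aux _ (Or.inr hw)

lemma mem_Xn (β : ℝ) (n : ℕ) (y : ℝ) : y ∈ Xn β n ↔ (y ∈ YY β n ∨ y = 1) := by
  simp [Xn, YY]; tauto

lemma pt_eq (β : ℝ) (n j : ℕ) (hj : j < (Xn β n).card) :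
    pt β n j = (Xn β n).orderEmbOfFin rfl ⟨j, hj⟩ := by
  rw [Finset.orderEmbOfFin_apply]
  unfold pt
  rw [List.getD_eq_getElem _ _ (by simpa using hj)]
  rfl

lemma pt_lt (β : ℝ) (n i j : ℕ) (hij : i < j) (hj : j < (Xn β n).card) :
    pt β n i < pt β n j := by
  rw [pt_eq β n i (hij.trans hj), pt_eq β n j hj]
  exact (Finset.orderEmbOfFin _ rfl).strictMono (by simpa using hij)

lemma pt_mem (β : ℝ) (n j : ℕ) (hj : j < (Xn β n).card) : pt β n j ∈ Xn β n := by
  rw [pt_eq β n j hj]; exact Finset.orderEmbOfFin_mem _ _ _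

lemma exists_pt (β : ℝ) (n : ℕ) (y : ℝ) (hy : y ∈ Xn β n) :
    ∃ j < (Xn β n).card, pt β n j = y := by
  have : y ∈ Set.range ((Xn β n).orderEmbOfFin rfl) := by
    rw [Finset.range_orderEmbOfFin]; exact hy
  obtain ⟨⟨j, hj⟩, h⟩ := this
  exact ⟨j, hj, by rw [pt_eq β n j hj, h]⟩

lemma pt_gap (m : ℕ) (hm : 2 ≤ m) (β : ℝ) (hβ1 : 1 < β) (hβ2 : β < 2)
    (hk : β ^ m * (2 - β) = 1) (n j : ℕ) (hj : j + 1 < (Xn β n).card) :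
    (1 - 1 / β) / β ^ n ≤ pt β n (j+1) - pt β n j ∧ pt β n (j+1) - pt β n j ≤ 1 / β ^ n := by
  have hb : 0 < β := by linarith
  have hlt := pt_lt β n j (j+1) (by omega) hj
  have h1 := (mem_Xn _ _ _).1 (pt_mem β n j (by omega))
  have h2 := (mem_Xn _ _ _).1 (pt_mem β n (j+1) hj)
  have h2' : pt β n (j+1) ≤ 1 := by
    rcases h2 with h | h
    · exact (YY_bounds β hβ1 n _ h).2.le
    · exact h.le
  rcases h1 with h1 | h1
  · obtain ⟨d, hd, h3, h4⟩ := gap m hm β hβ1 hβ2 hk n _ h1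
    obtain ⟨b1, b2⟩ := DD_bounds m β hβ1 hβ2 hk d hd
    have b3 : 0 < d / β ^ n := by
      have : 1 / β < 1 := by rw [div_lt_one hb]; exact hβ1
      exact div_pos (by linarith) (by positivity)
    have h5 : pt β n (j+1) = pt β n j + d / β ^ n := by
      apply le_antisymm
      · obtain ⟨k, hk, hk'⟩ := exists_pt β n _ ((mem_Xn _ _ _).2 h3)
        rw [← hk']
        have hjk : j < k := by
          by_contra hcon
          rcases Nat.lt_or_ge k j with h | h
          · have := pt_lt β n k j h (by omega); linarith
          · have : k = j := by omega
            subst this; linarith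
        rcases Nat.lt_or_ge (j+1) k with h | h
        · exact (pt_lt β n _ _ h hk).le
        · have : k = j + 1 := by omega
          rw [this]
      · rcases h4 _ h2 with h | h
        · linarith
        · exact h
    rw [h5, add_sub_cancel_left]
    constructor <;> gcongr
  · linarith

lemma pt_spread (m : ℕ) (hm : 2 ≤ m) (β : ℝ) (hβ1 : 1 < β) (hβ2 : β < 2)
    (hk : β ^ m * (2 - β) = 1) (n i : ℕ) (t : ℕ) (hj : i + t < (Xn β n).card) :
    t * ((1 - 1 / β) / β ^ n) ≤ pt β n (i+t) - pt β n i := by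
  induction t with
  | zero => simp
  | succ t ih =>
    have h1 := ih (by omega)
    have h2 := (pt_gap m hm β hβ1 hβ2 hk n (i+t) (by omega)).1
    rw [← add_assoc]; push_cast; linarith

/-- Every point of `[0,1]` lies in a basic interval. -/
lemma exists_interval (β : ℝ) (hβ1 : 1 < β) (n : ℕ) (x : ℝ) (hx : x ∈ Set.Icc (0:ℝ) 1) :
    ∃ i, i + 1 < (Xn β n).card ∧ x ∈ Set.Icc (pt β n i) (pt β n (i+1)) := by
  obtain ⟨i0, hi0, e0⟩ := exists_pt β n 0 ((mem_Xn _ _ _).2 (Or.inl (zero_mem_YY β hβ1 n)))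
  obtain ⟨i1, hi1, e1⟩ := exists_pt β n 1 ((mem_Xn _ _ _).2 (Or.inr rfl))
  have h01 : i0 < i1 := by
    by_contra hcon
    rcases Nat.lt_or_ge i1 i0 with h | h
    · have := pt_lt β n _ _ h hi0; linarith
    · have : i0 = i1 := by omega
      subst this; linarith
  have hex : ∃ k, i0 < k ∧ k < (Xn β n).card ∧ x ≤ pt β n k := ⟨i1, h01, hi1, by rw [e1]; exact hx.2⟩
  classical
  obtain ⟨g1, g2, g3⟩ := Nat.find_spec hex
  set k := Nat.find hex with hkdef
  refine ⟨k - 1, by omega, ?_, ?_⟩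
  · by_contra hcon
    push Not at hcon
    by_cases h : i0 < k - 1
    · exact Nat.find_min hex (m := k - 1) (by omega) ⟨h, by omega, hcon.le⟩
    · have : k - 1 = i0 := by omega
      rw [this, e0] at hcon
      linarith [hx.1]
  · rw [show k - 1 + 1 = k by omega]; exact g3

lemma measurable_Smap (β : ℝ) (i : Fin 2) : Measurable (Smap β i) := by
  unfold Smap
  split_ifs <;> fun_prop

lemma mu_unit (β : ℝ) (hβ1 : 1 < β) (p1 p2 : ℝ) (hp1 : 0 < p1) (hp2 : 0 < p2) (hp : p1 + p2 = 1)
    (μ : Measure ℝ) [IsProbabilityMeasure μ]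
    (hμ : μ = ENNReal.ofReal p1 • μ.map (Smap β 0) + ENNReal.ofReal p2 • μ.map (Smap β 1)) :
    μ (Set.Icc (0:ℝ) 1)ᶜ = 0 := by
  have hb : 0 < β := by linarith
  have step : ∀ t : ℝ, 0 ≤ t →
      μ (Set.Icc (-t) (1+t))ᶜ ≤ μ (Set.Icc (-(β*t)) (1+β*t))ᶜ := by
    intro t ht
    have hms : MeasurableSet (Set.Icc (-t) (1+t))ᶜ := measurableSet_Icc.compl
    have hinv : 1 / β < 1 := by rw [div_lt_one hb]; exact hβ1
    have sub : ∀ i : Fin 2, (Smap β i) ⁻¹' (Set.Icc (-t) (1+t))ᶜ ⊆ (Set.Icc (-(β*t)) (1+β*t))ᶜ := by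
      intro i x hx hx'
      apply hx
      obtain ⟨l, u⟩ := hx'
      have l' : -t ≤ x / β := by rw [le_div_iff₀ hb]; linarith
      have u' : x / β ≤ 1 / β + t := by
        rw [div_le_iff₀ hb, add_mul, div_mul_cancel₀ _ hb.ne']; linarith
      unfold Smap
      split_ifs <;> constructor <;> linarith
    calc μ (Set.Icc (-t) (1+t))ᶜ
        = ENNReal.ofReal p1 * μ ((Smap β 0) ⁻¹' (Set.Icc (-t) (1+t))ᶜ)
          + ENNReal.ofReal p2 * μ ((Smap β 1) ⁻¹' (Set.Icc (-t) (1+t))ᶜ) := by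
          conv_lhs => rw [hμ]
          rw [Measure.add_apply, Measure.smul_apply, Measure.smul_apply,
            Measure.map_apply (measurable_Smap β 0) hms, Measure.map_apply (measurable_Smap β 1) hms]
          rfl
      _ ≤ ENNReal.ofReal p1 * μ (Set.Icc (-(β*t)) (1+β*t))ᶜ
          + ENNReal.ofReal p2 * μ (Set.Icc (-(β*t)) (1+β*t))ᶜ := by
          gcongr
          · exact sub 0
          · exact sub 1
      _ = μ (Set.Icc (-(β*t)) (1+β*t))ᶜ := by
          rw [← add_mul, ← ENNReal.ofReal_add hp1.le hp2.le, hp]; simp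
  have iter : ∀ (k : ℕ) (t : ℝ), 0 ≤ t →
      μ (Set.Icc (-t) (1+t))ᶜ ≤ μ (Set.Icc (-(β^k*t)) (1+β^k*t))ᶜ := by
    intro k t ht
    induction k with
    | zero => simp
    | succ k ih =>
      refine ih.trans ((step (β^k*t) (by positivity)).trans (le_of_eq ?_))
      rw [pow_succ]; congr 3 <;> ring
  have zero : ∀ t : ℝ, 0 < t → μ (Set.Icc (-t) (1+t))ᶜ = 0 := by
    intro t ht
    have hanti : Antitone (fun k : ℕ => (Set.Icc (-(β^k*t)) (1+β^k*t))ᶜ) := by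
      intro a b hab
      have : β ^ a ≤ β ^ b := pow_le_pow_right₀ hβ1.le hab
      have : β ^ a * t ≤ β ^ b * t := by gcongr
      apply Set.compl_subset_compl.2
      apply Set.Icc_subset_Icc <;> linarith
    have hlim := tendsto_measure_iInter_atTop (μ := μ)
      (fun k => (measurableSet_Icc.compl : MeasurableSet (Set.Icc (-(β^k*t)) (1+β^k*t))ᶜ).nullMeasurableSet)
      hanti ⟨0, measure_ne_top _ _⟩
    have hempty : (⋂ k : ℕ, (Set.Icc (-(β^k*t)) (1+β^k*t))ᶜ) = ∅ := by
      apply Set.eq_empty_of_forall_notMem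
      intro x hx
      rw [Set.mem_iInter] at hx
      obtain ⟨k, hk⟩ := pow_unbounded_of_one_lt (|x| / t) hβ1
      rw [div_lt_iff₀ ht] at hk
      apply hx k
      have := abs_le.1 hk.le
      constructor <;> linarith [this.1, this.2]
    rw [hempty, measure_empty] at hlim
    exact le_antisymm (ge_of_tendsto' hlim (fun k => iter k t ht.le)) (zero_le)
  have hun : (Set.Icc (0:ℝ) 1)ᶜ ⊆ ⋃ k : ℕ, (Set.Icc (-(1/((k:ℝ)+1))) (1+1/((k:ℝ)+1)))ᶜ := by
    intro x hx
    rw [Set.mem_iUnion]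
    have hpos : 0 < max (-x) (x - 1) := by
      by_contra hcon
      push Not at hcon
      obtain ⟨h1, h2⟩ := max_le_iff.1 hcon
      exact hx ⟨by linarith, by linarith⟩
    obtain ⟨k, hk⟩ := exists_nat_one_div_lt hpos
    refine ⟨k, fun h => ?_⟩
    obtain ⟨h1, h2⟩ := h
    rcases lt_max_iff.1 hk with h | h <;> linarith
  exact measure_mono_null hun (measure_iUnion_null fun k => zero _ (by positivity))

lemma pt_unit (β : ℝ) (hβ1 : 1 < β) (n j : ℕ) (hj : j < (Xn β n).card) :
    pt β n j ∈ Set.Icc (0:ℝ) 1 := by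
  rcases (mem_Xn _ _ _).1 (pt_mem β n j hj) with h | h
  · have := YY_bounds β hβ1 n _ h
    exact ⟨this.1, this.2.le⟩
  · rw [h]; norm_num

lemma doubling_iter (μ : Measure ℝ) (D : ENNReal)
    (hD : ∀ x ∈ Set.Icc (0:ℝ) 1, ∀ r : ℝ, 0 < r →
      μ (Metric.closedBall x (2 * r)) ≤ D * μ (Metric.closedBall x r))
    (x : ℝ) (hx : x ∈ Set.Icc (0:ℝ) 1) (r : ℝ) (hr : 0 < r) (k : ℕ) :
    μ (Metric.closedBall x (2 ^ k * r)) ≤ D ^ k * μ (Metric.closedBall x r) := by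
  induction k with
  | zero => simp
  | succ k ih =>
    have := hD x hx (2 ^ k * r) (by positivity)
    rw [show (2:ℝ) ^ (k+1) * r = 2 * (2 ^ k * r) by ring]
    calc _ ≤ _ := this
      _ ≤ D * (D ^ k * μ (Metric.closedBall x r)) := by gcongr
      _ = _ := by rw [pow_succ]; ring

lemma ball_pos (μ : Measure ℝ) [IsProbabilityMeasure μ] (D : ENNReal)
    (hD : ∀ x ∈ Set.Icc (0:ℝ) 1, ∀ r : ℝ, 0 < r →
      μ (Metric.closedBall x (2 * r)) ≤ D * μ (Metric.closedBall x r))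
    (x : ℝ) (hx : x ∈ Set.Icc (0:ℝ) 1) (r : ℝ) (hr : 0 < r) :
    μ (Metric.closedBall x r) ≠ 0 := by
  intro h0
  have h1 : ∀ k : ℕ, μ (Metric.closedBall x (2 ^ k * r)) = 0 := by
    intro k
    have := doubling_iter μ D hD x hx r hr k
    rw [h0, mul_zero] at this
    exact le_antisymm this zero_le
  have h2 : μ Set.univ = 0 := by
    refine measure_mono_null ?_ (measure_iUnion_null h1)
    intro y _
    rw [Set.mem_iUnion]
    obtain ⟨k, hk⟩ := pow_unbounded_of_one_lt (dist y x / r) (by norm_num : (1:ℝ) < 2)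
    rw [div_lt_iff₀ hr] at hk
    exact ⟨k, hk.le⟩
  simp at h2

lemma Icc_ball (u v : ℝ) : Set.Icc u v = Metric.closedBall ((u+v)/2) ((v-u)/2) := by
  rw [Real.closedBall_eq_Icc]; congr 1 <;> ring

lemma interval_le (μ : Measure ℝ) (D : ENNReal)
    (hD : ∀ x ∈ Set.Icc (0:ℝ) 1, ∀ r : ℝ, 0 < r →
      μ (Metric.closedBall x (2 * r)) ≤ D * μ (Metric.closedBall x r))
    (a b u v : ℝ) (hu : u ∈ Set.Icc (0:ℝ) 1) (hv : v ∈ Set.Icc (0:ℝ) 1) (huv : u < v)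
    (k : ℕ) (h1 : (u+v)/2 - 2^k * ((v-u)/2) ≤ a) (h2 : b ≤ (u+v)/2 + 2^k * ((v-u)/2)) :
    μ (Set.Icc a b) ≤ D ^ k * μ (Set.Icc u v) := by
  have h := doubling_iter μ D hD ((u+v)/2) ⟨by linarith [hu.1, hv.1], by linarith [hu.2, hv.2]⟩
    ((v-u)/2) (by linarith) k
  rw [Icc_ball u v]
  refine le_trans (measure_mono ?_) h
  rw [Real.closedBall_eq_Icc]
  exact Set.Icc_subset_Icc h1 h2

lemma chain (g : ℕ → ENNReal) (C : ENNReal) (N : ℕ)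
    (h : ∀ j, j + 2 < N → g j ≤ C * g (j+1) ∧ g (j+1) ≤ C * g j) (i t : ℕ) (ht : i + t + 1 < N) :
    g (i+t) ≤ C ^ t * g i ∧ g i ≤ C ^ t * g (i+t) := by
  induction t with
  | zero => simp
  | succ t ih =>
    obtain ⟨h1, h2⟩ := ih (by omega)
    obtain ⟨h3, h4⟩ := h (i+t) (by omega)
    constructor
    · calc g (i+(t+1)) ≤ C * g (i+t) := h4
        _ ≤ C * (C ^ t * g i) := by gcongr
        _ = _ := by rw [pow_succ]; ring
    · calc g i ≤ C ^ t * g (i+t) := h2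
        _ ≤ C ^ t * (C * g (i+t+1)) := by gcongr
        _ = _ := by rw [pow_succ, ← add_assoc]; ring

lemma scale (β : ℝ) (hβ1 : 1 < β) (hβ2 : β < 2) (r : ℝ) (hr : 0 < r) :
    ∃ n, 2 ≤ n ∧ 1 / β ^ n ≤ r ∧ (1 ≤ 4 / β ^ n ∨ 2 * r ≤ 4 / β ^ n) := by
  have hb : 0 < β := by linarith
  have hex : ∃ n, 2 ≤ n ∧ 1 / β ^ n ≤ r := by
    obtain ⟨k, hk⟩ := pow_unbounded_of_one_lt (1 / r) hβ1
    refine ⟨k + 2, by omega, ?_⟩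
    have h1 : β ^ k ≤ β ^ (k+2) := pow_le_pow_right₀ hβ1.le (by omega)
    rw [div_le_iff₀ (by positivity)]
    rw [div_lt_iff₀ hr] at hk
    nlinarith
  classical
  obtain ⟨h1, h2⟩ := Nat.find_spec hex
  set n := Nat.find hex with hn
  refine ⟨n, h1, h2, ?_⟩
  by_cases h : n = 2
  · left
    rw [h, le_div_iff₀ (by positivity)]; nlinarith
  · right
    have h3 := Nat.find_min hex (m := n - 1) (by omega)
    have h4 : r < 1 / β ^ (n-1) := by
      by_contra hcon; exact h3 ⟨by omega, not_lt.1 hcon⟩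
    have h5 : β ^ n = β ^ (n-1) * β := by rw [← pow_succ]; congr 1; omega
    rw [lt_div_iff₀ (by positivity)] at h4
    rw [le_div_iff₀ (by positivity), h5]
    have : 0 < r * β ^ (n-1) := by positivity
    nlinarith

/-- `μ_p` is doubling iff the `μ_p`-measures of adjacent basic intervals
are uniformly comparable. -/
theorem stmt_8 (m : ℕ) (hm : 2 ≤ m) (β : ℝ) (hβ1 : 1 < β) (hβ2 : β < 2)
    (hβ : β ^ m = ∑ j ∈ Finset.range m, β ^ j)
    (p1 p2 : ℝ) (hp1 : 0 < p1) (hp2 : 0 < p2) (hp : p1 + p2 = 1)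
    (μ : Measure ℝ) [IsProbabilityMeasure μ]
    (hμ : μ = ENNReal.ofReal p1 • μ.map (Smap β 0) + ENNReal.ofReal p2 • μ.map (Smap β 1)) :
    IsDoubling μ ↔
      ∃ C₁' : ℝ, 0 < C₁' ∧ ∀ n, 2 ≤ n → ∀ j, j + 2 < (Xn β n).card →
        C₁'⁻¹ ≤ (μ (Set.Icc (pt β n j) (pt β n (j+1)))).toReal /
                  (μ (Set.Icc (pt β n (j+1)) (pt β n (j+2)))).toReal ∧
        (μ (Set.Icc (pt β n j) (pt β n (j+1)))).toReal /
          (μ (Set.Icc (pt β n (j+1)) (pt β n (j+2)))).toReal ≤ C₁' := by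
  have hb : 0 < β := by linarith
  have hk := key_eq m β hβ
  have hc : 0 < 1 - 1 / β := by
    have : 1 / β < 1 := by rw [div_lt_one hb]; exact hβ1
    linarith
  constructor
  · intro hdbl
    unfold IsDoubling at hdbl
    set D := (⨆ (x : ℝ) (_ : x ∈ Set.Icc (0:ℝ) 1) (r : ℝ) (_ : 0 < r),
      μ (Metric.closedBall x (2 * r)) / μ (Metric.closedBall x r)) with hDdef
    have hD : ∀ x ∈ Set.Icc (0:ℝ) 1, ∀ r : ℝ, 0 < r →
        μ (Metric.closedBall x (2 * r)) ≤ D * μ (Metric.closedBall x r) := by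
      intro x hx r hr
      have : μ (Metric.closedBall x (2 * r)) / μ (Metric.closedBall x r) ≤ D :=
        le_iSup₂_of_le x hx (le_iSup₂_of_le r hr le_rfl)
      exact (ENNReal.div_le_iff_le_mul (Or.inr hdbl.ne) (Or.inl (measure_ne_top _ _))).1 this
    obtain ⟨k, hk3⟩ := pow_unbounded_of_one_lt (3 / (1 - 1 / β)) (by norm_num : (1:ℝ) < 2)
    rw [div_lt_iff₀ hc] at hk3
    have hDk : D ^ k ≠ ⊤ := ENNReal.pow_ne_top hdbl.ne
    set C := (D ^ k).toReal + 1 with hC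
    have hC0 : 0 < C := by positivity
    have toR : ∀ s t : Set ℝ, μ s ≤ D ^ k * μ t → (μ s).toReal ≤ C * (μ t).toReal := by
      intro s t h
      have h1 := ENNReal.toReal_mono (ENNReal.mul_ne_top hDk (measure_ne_top _ _)) h
      rw [ENNReal.toReal_mul] at h1
      have : 0 ≤ (μ t).toReal := ENNReal.toReal_nonneg
      rw [hC]; nlinarith
    refine ⟨C, hC0, ?_⟩
    intro n hn j hj
    obtain ⟨a1, a2⟩ := pt_gap m hm β hβ1 hβ2 hk n j (by omega)
    obtain ⟨b1, b2⟩ := pt_gap m hm β hβ1 hβ2 hk n (j+1) (by omega)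
    have u0 := pt_unit β hβ1 n j (by omega)
    have u1 := pt_unit β hβ1 n (j+1) (by omega)
    have u2 := pt_unit β hβ1 n (j+2) (by omega)
    have hq : 0 < 1 / β ^ n := by positivity
    have hcq : 0 < (1 - 1 / β) / β ^ n := by positivity
    have big : ∀ l : ℝ, (1 - 1 / β) / β ^ n ≤ l → 3 * (1 / β ^ n) ≤ 2 ^ k * l := by
      intro l hl
      calc 3 * (1 / β ^ n) ≤ (2 ^ k * (1 - 1 / β)) * (1 / β ^ n) := by gcongr
        _ = 2 ^ k * ((1 - 1 / β) / β ^ n) := by ring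
        _ ≤ _ := by gcongr
    rw [show j + 1 + 1 = j + 2 from rfl] at b1 b2
    have big1 := big _ a1
    have big2 := big _ b1
    have k1 := toR _ _ (interval_le μ D hD (pt β n j) (pt β n (j+1)) (pt β n (j+1)) (pt β n (j+2))
      u1 u2 (by linarith) k (by linarith) (by linarith))
    have k2 := toR _ _ (interval_le μ D hD (pt β n (j+1)) (pt β n (j+2)) (pt β n j) (pt β n (j+1))
      u0 u1 (by linarith) k (by linarith) (by linarith))
    have pos : 0 < (μ (Set.Icc (pt β n (j+1)) (pt β n (j+2)))).toReal := by
      apply ENNReal.toReal_pos _ (measure_ne_top _ _)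
      rw [Icc_ball]
      exact ball_pos μ D hD _ ⟨by linarith [u1.1, u2.1], by linarith [u1.2, u2.2]⟩ _ (by linarith)
    constructor
    · rw [le_div_iff₀ pos, inv_mul_le_iff₀ hC0]; exact k2
    · rw [div_le_iff₀ pos]; exact k1
  · rintro ⟨C, hC, hall⟩
    have hsupp := mu_unit β hβ1 p1 p2 hp1 hp2 hp μ hμ
    set E := ENNReal.ofReal (C + 1) with hE
    have hE1 : 1 ≤ E := by rw [hE, ENNReal.one_le_ofReal]; linarith
    obtain ⟨K0, hK0⟩ := exists_nat_gt (4 / (1 - 1 / β))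
    rw [div_lt_iff₀ hc] at hK0
    set K := K0 + 1 with hKdef
    have hfin : ((2 * K + 1 : ℕ) : ENNReal) * E ^ K < ⊤ :=
      ENNReal.mul_lt_top (ENNReal.natCast_lt_top _) (ENNReal.pow_lt_top ENNReal.ofReal_lt_top)
    refine lt_of_le_of_lt ?_ hfin
    refine iSup₂_le fun x hx => iSup₂_le fun r hr => ?_
    apply ENNReal.div_le_of_le_mul
    obtain ⟨n, hn, hnr, hn4⟩ := scale β hβ1 hβ2 r hr
    have hcq : 0 < (1 - 1 / β) / β ^ n := by positivity
    obtain ⟨i, hi, hxi⟩ := exists_interval β hβ1 n x hx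
    set J : ℕ → Set ℝ := fun j => Set.Icc (pt β n j) (pt β n (j+1)) with hJ
    have hadj : ∀ j, j + 2 < (Xn β n).card →
        μ (J j) ≤ E * μ (J (j+1)) ∧ μ (J (j+1)) ≤ E * μ (J j) := by
      intro j hj
      obtain ⟨h1, h2⟩ := hall n hn j hj
      have pos : 0 < (μ (Set.Icc (pt β n (j+1)) (pt β n (j+2)))).toReal := by
        rcases (ENNReal.toReal_nonneg :
          0 ≤ (μ (Set.Icc (pt β n (j+1)) (pt β n (j+2)))).toReal).eq_or_lt with h | h
        · rw [← h, div_zero] at h1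
          have := inv_pos.2 hC
          linarith
        · exact h
      rw [le_div_iff₀ pos, inv_mul_le_iff₀ hC] at h1
      rw [div_le_iff₀ pos] at h2
      have toE : ∀ s t : Set ℝ, (μ s).toReal ≤ C * (μ t).toReal → μ s ≤ E * μ t := by
        intro s t h
        rw [← ENNReal.ofReal_toReal (measure_ne_top μ s), ← ENNReal.ofReal_toReal (measure_ne_top μ t),
          hE, ← ENNReal.ofReal_mul (by linarith)]
        apply ENNReal.ofReal_le_ofReal
        have : 0 ≤ (μ t).toReal := ENNReal.toReal_nonneg
        linarith
      exact ⟨toE _ _ h2, toE _ _ h1⟩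
    have hchain := chain (fun j => μ (J j)) E (Xn β n).card hadj
    set F := (Finset.range ((Xn β n).card - 1)).filter (fun k => k ≤ i + K ∧ i ≤ k + K) with hF
    have hFcard : F.card ≤ 2 * K + 1 := by
      have : F ⊆ Finset.Icc (i - K) (i + K) := by
        intro k hk
        simp only [hF, Finset.mem_filter, Finset.mem_range] at hk
        rw [Finset.mem_Icc]; omega
      have := Finset.card_le_card this
      rw [Nat.card_Icc] at this
      omega
    have hFle : ∀ k ∈ F, μ (J k) ≤ E ^ K * μ (J i) := by
      intro k hk
      simp only [hF, Finset.mem_filter, Finset.mem_range] at hk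
      rcases le_total i k with h | h
      · obtain ⟨t, rfl⟩ := Nat.exists_eq_add_of_le h
        refine ((hchain i t (by omega)).1).trans ?_
        gcongr
        · omega
      · obtain ⟨t, rfl⟩ := Nat.exists_eq_add_of_le h
        refine ((hchain k t (by omega)).2).trans ?_
        gcongr
        · omega
    have hJi : J i ⊆ Metric.closedBall x r := by
      have hg := (pt_gap m hm β hβ1 hβ2 hk n i hi).2
      rw [Real.closedBall_eq_Icc]
      exact Set.Icc_subset_Icc (by linarith [hxi.2]) (by linarith [hxi.1])
    have hcov : Metric.closedBall x (2 * r) ⊆ (Set.Icc (0:ℝ) 1)ᶜ ∪ ⋃ k ∈ F, J k := by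
      intro y hy
      by_cases hy1 : y ∈ Set.Icc (0:ℝ) 1
      swap
      · exact Or.inl hy1
      right
      obtain ⟨k, hkN, hyk⟩ := exists_interval β hβ1 n y hy1
      simp only [Set.mem_iUnion]
      refine ⟨k, ?_, hyk⟩
      rw [Real.closedBall_eq_Icc] at hy
      have hd1 : y - x ≤ 4 / β ^ n := by
        rcases hn4 with h | h
        · linarith [hx.1, hy1.2]
        · linarith [hy.2]
      have hd2 : x - y ≤ 4 / β ^ n := by
        rcases hn4 with h | h
        · linarith [hx.2, hy1.1]
        · linarith [hy.1]
      have hbig : 4 / β ^ n < K0 * ((1 - 1 / β) / β ^ n) := by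
        rw [← mul_div_assoc]; gcongr
      have far : ∀ a b : ℕ, b + 1 < (Xn β n).card → a + K < b →
          4 / β ^ n < pt β n b - pt β n (a+1) := by
        intro a b hb1 hab
        obtain ⟨t, rfl⟩ := Nat.exists_eq_add_of_lt hab
        have h := pt_spread m hm β hβ1 hβ2 hk n (a+1) (K0 + (t + 1)) (by omega)
        rw [show a + 1 + (K0 + (t+1)) = a + K + t + 1 by omega] at h
        push_cast at h
        have : 0 ≤ ((t:ℝ) + 1) * ((1 - 1 / β) / β ^ n) := by positivity
        linarith
      simp only [hF, Finset.mem_filter, Finset.mem_range]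
      refine ⟨by omega, ?_, ?_⟩
      · by_contra hcon
        have := far i k hkN (by omega)
        linarith [hyk.1, hxi.2]
      · by_contra hcon
        have := far k i hi (by omega)
        linarith [hyk.2, hxi.1]
    calc μ (Metric.closedBall x (2 * r))
        ≤ μ ((Set.Icc (0:ℝ) 1)ᶜ ∪ ⋃ k ∈ F, J k) := measure_mono hcov
      _ ≤ μ (Set.Icc (0:ℝ) 1)ᶜ + μ (⋃ k ∈ F, J k) := measure_union_le _ _
      _ = μ (⋃ k ∈ F, J k) := by rw [hsupp, zero_add]
      _ ≤ ∑ k ∈ F, μ (J k) := measure_biUnion_finset_le _ _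
      _ ≤ ∑ k ∈ F, E ^ K * μ (J i) := Finset.sum_le_sum hFle
      _ = (F.card : ENNReal) * (E ^ K * μ (J i)) := by rw [Finset.sum_const, nsmul_eq_mul]
      _ ≤ ((2 * K + 1 : ℕ) : ENNReal) * (E ^ K * μ (Metric.closedBall x r)) := by
          gcongr
      _ = _ := by rw [mul_assoc]
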